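/- arXiv:1507.07151 — 5 statements merged into one kernel-verified Lean document; each statement's English description precedes it below -/
import Mathlib

section
/- Let (n,s,L) be a tree with n ≥ 2 (so that the root n is not a leaf), and write s⁻¹(n) = {k₁ < k₂ < … < k_m}. Then k_m = n−1. Moreover, putting k₀ = 0 and nᵢ = kᵢ − k_{i−1} for i = 1,…,m, the data (nᵢ, sᵢ, Lᵢ) defined by sᵢ(j) = s(j + k_{i−1}) − k_{i−1} for j ∈ {1,…,nᵢ−1} and Lᵢ = {x − k_{i−1} : x ∈ L} ∩ {1,…,nᵢ} are well defined (i.e., s(j + k_{i−1}) − k_{i−1} ∈ {1,…,nᵢ} ∖ Lᵢ for 1 ≤ j ≤ nᵢ−1) and each (nᵢ, sᵢ, Lᵢ) is again a tree. -/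
def IsTree (n : ℕ) (s : ℕ → ℕ) (L : Finset ℕ) : Prop :=
  L ⊆ Finset.Icc 1 n ∧
  (∀ x ∈ Finset.Icc 1 (n - 1), s x ∈ Finset.Icc 1 n ∧ s x ∉ L) ∧
  (∀ x ∈ Finset.Icc 1 (n - 1), x < s x) ∧
  (∀ x y, x ∈ Finset.Icc 1 (n - 1) → y ∈ Finset.Icc 1 (n - 1) →
    x ≤ y → y < s x → s y ≤ s x)

def SuccessorData (n : ℕ) (s : ℕ → ℕ) (m : ℕ) (k : ℕ → ℕ) : Prop :=
  k 0 = 0 ∧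
  (∀ i j, i < j → j ≤ m → k i < k j) ∧
  (∀ x, (x ∈ Finset.Icc 1 (n - 1) ∧ s x = n) ↔ ∃ i ∈ Finset.Icc 1 m, k i = x)

def succN (k : ℕ → ℕ) (i : ℕ) : ℕ := k i - k (i - 1)

def succS (s k : ℕ → ℕ) (i : ℕ) : ℕ → ℕ := fun j => s (j + k (i - 1)) - k (i - 1)

def succL (L : Finset ℕ) (k : ℕ → ℕ) (i : ℕ) : Finset ℕ :=
  (L.image fun x => x - k (i - 1)) ∩ Finset.Icc 1 (succN k i)

theorem IsTree.apply_pred {n : ℕ} {s : ℕ → ℕ} {L : Finset ℕ} (h : IsTree n s L) (hn : 2 ≤ n) :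
    s (n - 1) = n := by
  have hmem : n - 1 ∈ Finset.Icc 1 (n - 1) := Finset.mem_Icc.2 (by omega)
  have hle := (Finset.mem_Icc.1 (h.2.1 _ hmem).1).2
  have hlt := h.2.2.1 _ hmem
  omega

/-- Strictly between `a` and a child `b` of the root, with no child of the root in between,
the successor function stays at most `b`. -/
theorem IsTree.apply_le_of_lt_child {n : ℕ} {s : ℕ → ℕ} {L : Finset ℕ} (h : IsTree n s L)
    {x b : ℕ} (hx : 1 ≤ x) (hxb : x < b) (hb : b ≤ n - 1) (hsb : s b = n) (hsx : s x ≠ n) :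
    s x ≤ b := by
  have hmem : x ∈ Finset.Icc 1 (n - 1) := Finset.mem_Icc.2 (by omega)
  have hle := (Finset.mem_Icc.1 (h.2.1 _ hmem).1).2
  by_contra! hlt
  have := h.2.2.2 x b hmem (Finset.mem_Icc.2 (by omega)) hxb.le hlt
  omega

theorem SuccessorData.apply_ne_of_lt_of_lt {n m i x : ℕ} {s k : ℕ → ℕ}
    (h : SuccessorData n s m k) (hi : i ≤ m) (hx : x ∈ Finset.Icc 1 (n - 1))
    (hlt : k (i - 1) < x) (hxi : x < k i) : s x ≠ n := by
  intro hs
  obtain ⟨j, hj, rfl⟩ := (h.2.2 x).1 ⟨hx, hs⟩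
  rw [Finset.mem_Icc] at hj
  rcases lt_trichotomy j i with hji | rfl | hji
  · rcases (show j ≤ i - 1 by omega).eq_or_lt with rfl | hj'
    · omega
    · have := h.2.1 j (i - 1) hj' (by omega)
      omega
  · omega
  · have := h.2.1 i j hji hj.2
    omega

theorem statement0 (n : ℕ) (s : ℕ → ℕ) (L : Finset ℕ)
    (htree : IsTree n s L) (hn : 2 ≤ n)
    (m : ℕ) (k : ℕ → ℕ) (hk : SuccessorData n s m k) :
    k m = n - 1 ∧
    ∀ i ∈ Finset.Icc 1 m, IsTree (succN k i) (succS s k i) (succL L k i) := by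
  have hmono := hk.2.1
  constructor
  · obtain ⟨i, hi, hki⟩ := (hk.2.2 (n - 1)).1
      ⟨Finset.mem_Icc.2 (by omega), htree.apply_pred hn⟩
    rw [Finset.mem_Icc] at hi
    have hm := (hk.2.2 (k m)).2 ⟨m, Finset.mem_Icc.2 (by omega), rfl⟩
    have hle := (Finset.mem_Icc.1 hm.1).2
    rcases hi.2.eq_or_lt with rfl | him
    · exact hki
    · have := hmono i m him le_rfl
      omega
  · intro i hi
    obtain ⟨hb, hsb⟩ := (hk.2.2 (k i)).2 ⟨i, hi, rfl⟩
    rw [Finset.mem_Icc] at hi hb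
    have hab : k (i - 1) < k i := hmono _ _ (by omega) hi.2
    have hmem : ∀ j ∈ Finset.Icc 1 (succN k i - 1),
        j + k (i - 1) ∈ Finset.Icc 1 (n - 1) ∧ j + k (i - 1) < k i := by
      intro j hj
      simp only [succN, Finset.mem_Icc] at hj ⊢
      omega
    have hle : ∀ j ∈ Finset.Icc 1 (succN k i - 1), s (j + k (i - 1)) ≤ k i := by
      intro j hj
      obtain ⟨h1, h2⟩ := hmem j hj
      rw [Finset.mem_Icc] at hj
      exact htree.apply_le_of_lt_child (Finset.mem_Icc.1 h1).1 h2 hb.2 hsb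
        (hk.apply_ne_of_lt_of_lt hi.2 h1 (by omega) h2)
    have hlt : ∀ j ∈ Finset.Icc 1 (succN k i - 1), j + k (i - 1) < s (j + k (i - 1)) :=
      fun j hj => htree.2.2.1 _ (hmem j hj).1
    refine ⟨Finset.inter_subset_right, fun j hj => ⟨?_, ?_⟩, fun j hj => ?_,
      fun x y hx hy hxy hys => ?_⟩
    · have := hle j hj
      have := hlt j hj
      simp only [succN, succS, Finset.mem_Icc]
      omega
    · intro hL
      simp only [succL, succS, Finset.mem_inter, Finset.mem_image] at hL
      obtain ⟨⟨x, hxL, hx⟩, -⟩ := hL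
      have := hlt j hj
      rw [Finset.mem_Icc] at hj
      obtain rfl : x = s (j + k (i - 1)) := by omega
      exact (htree.2.1 _ (hmem j (Finset.mem_Icc.2 hj)).1).2 hxL
    · have := hlt j hj
      simp only [succS]
      omega
    · simp only [succS] at hys ⊢
      exact Nat.sub_le_sub_right (htree.2.2.2 _ _ (hmem x hx).1 (hmem y hy).1
        (by omega) (by omega)) _
end

section
/- Let (n,s,L) be a tree with n ≥ 2 whose sequence of successor trees is (n₁,s₁,L₁),…,(n_m,s_m,L_m), and let σ : {1,…,m} → {1,…,m} be a permutation. Then there exists a unique tree (n, s^σ, L^σ) whose sequence of successor trees is (n_{σ(1)}, s_{σ(1)}, L_{σ(1)}),…,(n_{σ(m)}, s_{σ(m)}, L_{σ(m)}). -/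
/-- Two trees are equal as trees: same size, same leaves, and the successor
functions agree on the domain `{1,…,n-1}`. -/
def TreeEq (n₁ : ℕ) (s₁ : ℕ → ℕ) (L₁ : Finset ℕ)
    (n₂ : ℕ) (s₂ : ℕ → ℕ) (L₂ : Finset ℕ) : Prop :=
  n₁ = n₂ ∧ L₁ = L₂ ∧ ∀ j ∈ Finset.Icc 1 (n₁ - 1), s₁ j = s₂ j

/-- `(n, s', L')` is a tree whose sequence of successor trees is the `σ`-permuted
sequence of successor trees of `(n, s, L)` (the latter being encoded by the
successor data `(m, k)`). -/
def HasPermutedSuccessors (n : ℕ) (s : ℕ → ℕ) (L : Finset ℕ) (m : ℕ) (k : ℕ → ℕ)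
    (σ : ℕ → ℕ) (s' : ℕ → ℕ) (L' : Finset ℕ) : Prop :=
  IsTree n s' L' ∧
  ∃ k' : ℕ → ℕ, SuccessorData n s' m k' ∧
    ∀ i ∈ Finset.Icc 1 m,
      TreeEq (succN k' i) (succS s' k' i) (succL L' k' i)
        (succN k (σ i)) (succS s k (σ i)) (succL L k (σ i))

theorem exists_block {m : ℕ} {k : ℕ → ℕ} (hk0 : k 0 = 0) {x : ℕ} (hx : 1 ≤ x)
    (hxm : x ≤ k m) : ∃ i, 1 ≤ i ∧ i ≤ m ∧ k (i - 1) < x ∧ x ≤ k i := by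
  induction m with
  | zero => omega
  | succ m ih =>
    by_cases h : x ≤ k m
    · obtain ⟨i, h1, h2, h3⟩ := ih h
      exact ⟨i, h1, by omega, h3⟩
    · exact ⟨m + 1, by omega, le_rfl, by simpa using h, hxm⟩

theorem block_unique {m : ℕ} {k : ℕ → ℕ} (hmono : ∀ i j, i < j → j ≤ m → k i < k j)
    {i j x : ℕ} (hi1 : 1 ≤ i) (hi : i ≤ m) (hj1 : 1 ≤ j) (hj : j ≤ m)
    (hix : k (i - 1) < x) (hxi : x ≤ k i) (hjx : k (j - 1) < x) (hxj : x ≤ k j) :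
    i = j := by
  have mono : ∀ a b, a ≤ b → b ≤ m → k a ≤ k b := fun a b hab hb => by
    rcases hab.eq_or_lt with rfl | h
    · exact le_rfl
    · exact (hmono a b h hb).le
  rcases lt_trichotomy i j with h | h | h
  · have := mono i (j - 1) (by omega) (by omega)
    omega
  · exact h
  · have := mono j (i - 1) (by omega) (by omega)
    omega

theorem IsTree.root_notMem {n : ℕ} {s : ℕ → ℕ} {L : Finset ℕ} (h : IsTree n s L) (hn : 2 ≤ n) :
    n ∉ L := by
  have hm : n - 1 ∈ Finset.Icc 1 (n - 1) := by simp; omega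
  have := (h.2.1 _ hm).2
  rwa [h.apply_pred hn] at this

theorem SuccessorData.bounds {n m : ℕ} {s k : ℕ → ℕ} (hk : SuccessorData n s m k) {i : ℕ}
    (hi1 : 1 ≤ i) (hi : i ≤ m) : 1 ≤ k i ∧ k i ≤ n - 1 ∧ s (k i) = n := by
  have := (hk.2.2 (k i)).2 ⟨i, by simp; omega, rfl⟩
  simp only [Finset.mem_Icc] at this
  omega

theorem SuccessorData.apply_last {n m : ℕ} {s k : ℕ → ℕ} {L : Finset ℕ} (hk : SuccessorData n s m k)
    (h : IsTree n s L) (hn : 2 ≤ n) : k m = n - 1 := by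
  obtain ⟨i, hi, hki⟩ := (hk.2.2 (n - 1)).1 ⟨by simp; omega, h.apply_pred hn⟩
  simp only [Finset.mem_Icc] at hi
  rcases hi.2.eq_or_lt with rfl | hlt
  · exact hki
  · have := hk.2.1 i m hlt le_rfl
    have := hk.bounds (i := m) (by omega) le_rfl
    omega

/-- The successor function maps the interior of a block into that block. -/
theorem SuccessorData.apply_le {n m : ℕ} {s k : ℕ → ℕ} {L : Finset ℕ} (hk : SuccessorData n s m k)
    (h : IsTree n s L) {i x : ℕ} (hi1 : 1 ≤ i) (hi : i ≤ m) (hx : k (i - 1) < x)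
    (hxi : x < k i) : s x ≤ k i := by
  by_contra! hlt
  obtain ⟨b1, b2, b3⟩ := hk.bounds hi1 hi
  have hxm : x ∈ Finset.Icc 1 (n - 1) := by simp; omega
  have h4 := h.2.2.2 x (k i) hxm (by simp; omega) hxi.le hlt
  have h2 := (h.2.1 x hxm).1
  simp only [Finset.mem_Icc] at h2
  obtain ⟨j, hj, rfl⟩ := (hk.2.2 x).1 ⟨hxm, by omega⟩
  simp only [Finset.mem_Icc] at hj
  have := block_unique hk.2.1 hi1 hi hj.1 hj.2 hx hxi.le
    (hk.2.1 (j - 1) j (by omega) hj.2) le_rfl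
  subst this
  omega

theorem mem_succL {L : Finset ℕ} {k : ℕ → ℕ} {i j : ℕ} :
    j ∈ succL L k i ↔ j + k (i - 1) ∈ L ∧ 1 ≤ j ∧ j ≤ succN k i := by
  simp only [succL, Finset.mem_inter, Finset.mem_image, Finset.mem_Icc]
  constructor
  · rintro ⟨⟨x, hx, rfl⟩, h1, h2⟩
    rw [Nat.sub_add_cancel (by omega)]
    exact ⟨hx, h1, h2⟩
  · rintro ⟨hx, h⟩
    exact ⟨⟨_, hx, by simp⟩, h⟩

theorem TreeEq.symm {n₁ n₂ : ℕ} {s₁ s₂ : ℕ → ℕ} {L₁ L₂ : Finset ℕ}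
    (h : TreeEq n₁ s₁ L₁ n₂ s₂ L₂) : TreeEq n₂ s₂ L₂ n₁ s₁ L₁ := by
  obtain ⟨rfl, rfl, h⟩ := h
  exact ⟨rfl, rfl, fun j hj => (h j hj).symm⟩

theorem TreeEq.trans {n₁ n₂ n₃ : ℕ} {s₁ s₂ s₃ : ℕ → ℕ} {L₁ L₂ L₃ : Finset ℕ}
    (h : TreeEq n₁ s₁ L₁ n₂ s₂ L₂) (hab : TreeEq n₂ s₂ L₂ n₃ s₃ L₃) :
    TreeEq n₁ s₁ L₁ n₃ s₃ L₃ := by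
  obtain ⟨rfl, rfl, h⟩ := h
  obtain ⟨rfl, rfl, hab⟩ := hab
  exact ⟨rfl, rfl, fun j hj => (h j hj).trans (hab j hj)⟩

/-- A tree is determined by its sequence of successor trees. -/
theorem treeEq_of_successors {n m : ℕ} {s₁ s₂ k₁ k₂ : ℕ → ℕ} {L₁ L₂ : Finset ℕ} (hn : 2 ≤ n)
    (h₁ : IsTree n s₁ L₁) (h₂ : IsTree n s₂ L₂)
    (hk₁ : SuccessorData n s₁ m k₁) (hk₂ : SuccessorData n s₂ m k₂)
    (h : ∀ i ∈ Finset.Icc 1 m, TreeEq (succN k₁ i) (succS s₁ k₁ i) (succL L₁ k₁ i)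
      (succN k₂ i) (succS s₂ k₂ i) (succL L₂ k₂ i)) :
    TreeEq n s₁ L₁ n s₂ L₂ := by
  have hkk : ∀ i ≤ m, k₁ i = k₂ i := by
    intro i
    induction i with
    | zero => intro _; rw [hk₁.1, hk₂.1]
    | succ i ih =>
      intro hi
      have e := (h (i + 1) (by simp; omega)).1
      have a := hk₁.2.1 i (i + 1) (by omega) hi
      have b := hk₂.2.1 i (i + 1) (by omega) hi
      have c := ih (by omega)
      simp only [succN, Nat.add_sub_cancel] at e
      omega
  have hlast := hk₁.apply_last h₁ hn
  refine ⟨rfl, ?_, fun x hx => ?_⟩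
  · ext x
    by_cases hx : 1 ≤ x ∧ x ≤ n - 1
    · obtain ⟨i, hi1, hi, hix, hxi⟩ := exists_block hk₁.1 hx.1 (hlast ▸ hx.2)
      have e := congrArg (x - k₁ (i - 1) ∈ ·) (h i (by simp; omega)).2.1
      have c := hkk (i - 1) (by omega)
      have d := hkk i hi
      simp only [mem_succL, succN, ← c, ← d] at e
      rw [Nat.sub_add_cancel hix.le] at e
      have p : 1 ≤ x - k₁ (i - 1) ∧ x - k₁ (i - 1) ≤ k₁ i - k₁ (i - 1) := by omega
      simpa [p] using e
    · by_cases hxn : x = n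
      · subst hxn
        simp [h₁.root_notMem hn, h₂.root_notMem hn]
      · have p : x ∉ Finset.Icc 1 n := by simp; omega
        exact iff_of_false (fun q => p (h₁.1 q)) (fun q => p (h₂.1 q))
  · have hx' := Finset.mem_Icc.1 hx
    obtain ⟨i, hi1, hi, hix, hxi⟩ := exists_block hk₁.1 hx'.1 (hlast ▸ hx'.2)
    have c := hkk (i - 1) (by omega)
    have d := hkk i hi
    rcases hxi.eq_or_lt with rfl | hlt
    · rw [(hk₁.bounds hi1 hi).2.2, d, (hk₂.bounds hi1 hi).2.2]
    · have e := (h i (by simp; omega)).2.2 (x - k₁ (i - 1)) (by simp [succN]; omega)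
      simp only [succS, ← c] at e
      rw [Nat.sub_add_cancel hix.le] at e
      have := h₁.2.2.1 x hx
      have := h₂.2.2.1 x hx
      omega

/-- The prefix sums of the sizes of the permuted successor trees. -/
def permutedCut (k σ : ℕ → ℕ) (i : ℕ) : ℕ := ∑ j ∈ Finset.Icc 1 i, succN k (σ j)

theorem permutedCut_eq {k σ : ℕ → ℕ} {i : ℕ} (hi : 1 ≤ i) :
    permutedCut k σ i = permutedCut k σ (i - 1) + succN k (σ i) := by
  obtain ⟨i, rfl⟩ := Nat.exists_eq_add_of_le' hi
  simp [permutedCut, Finset.sum_Icc_succ_top]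

theorem permutedCut_last {m : ℕ} {k σ : ℕ → ℕ} (hk0 : k 0 = 0)
    (hmono : ∀ i j, i < j → j ≤ m → k i < k j)
    (hσ : Set.BijOn σ (Set.Icc 1 m) (Set.Icc 1 m)) : permutedCut k σ m = k m := by
  have h1 : permutedCut k σ m = ∑ j ∈ Finset.Icc 1 m, succN k j := by
    refine Finset.sum_nbij σ ?_ ?_ ?_ fun _ _ => rfl
    · intro a ha
      simpa using hσ.mapsTo (by simpa using ha)
    · simpa using hσ.injOn
    · simpa using hσ.surjOn
  have h2 : ∀ i ≤ m, ∑ j ∈ Finset.Icc 1 i, succN k j = k i := by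
    intro i
    induction i with
    | zero => simp [hk0]
    | succ i ih =>
      intro hi
      rw [Finset.sum_Icc_succ_top (by omega), ih (by omega)]
      have := hmono i (i + 1) (by omega) hi
      simp only [succN, Nat.add_sub_cancel]
      omega
  rw [h1, h2 m le_rfl]

theorem exists_hasPermutedSuccessors {n m : ℕ} {s k σ : ℕ → ℕ} {L : Finset ℕ}
    (htree : IsTree n s L) (hn : 2 ≤ n) (hk : SuccessorData n s m k)
    (hσ : Set.BijOn σ (Set.Icc 1 m) (Set.Icc 1 m)) :
    ∃ s' L', HasPermutedSuccessors n s L m k σ s' L' := by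
  classical
  obtain ⟨c, hc⟩ : ∃ c, c = permutedCut k σ := ⟨_, rfl⟩
  have hc0 : c 0 = 0 := by simp [hc, permutedCut]
  have hcm : c m = n - 1 := by
    rw [hc, permutedCut_last hk.1 hk.2.1 hσ, hk.apply_last htree hn]
  have hσm : ∀ i, 1 ≤ i → i ≤ m → 1 ≤ σ i ∧ σ i ≤ m := fun i h1 h2 => hσ.mapsTo ⟨h1, h2⟩
  have hkσ : ∀ i, 1 ≤ i → i ≤ m → k (σ i - 1) < k (σ i) := fun i h1 h2 =>
    hk.2.1 _ _ (by have := hσm i h1 h2; omega) (hσm i h1 h2).2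
  have hcs : ∀ i, 1 ≤ i → i ≤ m → c i - c (i - 1) = k (σ i) - k (σ i - 1) ∧ c (i - 1) < c i := by
    intro i h1 h2
    have e : c i = c (i - 1) + succN k (σ i) := hc ▸ permutedCut_eq h1
    have := hkσ i h1 h2
    simp only [succN] at e
    omega
  have hcmono : ∀ i j, i < j → j ≤ m → c i < c j := by
    intro i j hij
    induction hij with
    | refl => intro h; simpa using (hcs (i + 1) (by omega) h).2
    | @step j _ ih =>
      intro h
      have := (hcs (j + 1) (by omega) h).2
      have := ih (by omega)
      simp only [Nat.add_sub_cancel, Nat.succ_eq_add_one] at *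
      omega
  have hcle : ∀ i ≤ m, c i ≤ n - 1 := by
    intro i hi
    rcases hi.eq_or_lt with rfl | h
    · omega
    · have := hcmono i m h le_rfl
      omega
  have hex : ∀ x, ∃ i, 1 ≤ x ∧ x ≤ n - 1 → 1 ≤ i ∧ i ≤ m ∧ c (i - 1) < x ∧ x ≤ c i := by
    intro x
    by_cases hx : 1 ≤ x ∧ x ≤ n - 1
    · obtain ⟨i, hi⟩ := exists_block hc0 hx.1 (hcm ▸ hx.2)
      exact ⟨i, fun _ => hi⟩
    · exact ⟨0, fun h => absurd h hx⟩
  choose b hb using hex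
  have hbu : ∀ i x, 1 ≤ i → i ≤ m → c (i - 1) < x → x ≤ c i → b x = i := by
    intro i x h1 h2 h3 h4
    have := hcle i h2
    obtain ⟨p1, p2, p3, p4⟩ := hb x (by omega)
    exact block_unique hcmono p1 p2 h1 h2 p3 p4 h3 h4
  obtain ⟨s', hs'⟩ : ∃ s' : ℕ → ℕ, s' = fun x => if x = c (b x) then n else
    s (x - c (b x - 1) + k (σ (b x) - 1)) - k (σ (b x) - 1) + c (b x - 1) := ⟨_, rfl⟩
  obtain ⟨L', hL'⟩ : ∃ L' : Finset ℕ, L' = (Finset.Icc 1 (n - 1)).filter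
    fun x => x - c (b x - 1) + k (σ (b x) - 1) ∈ L := ⟨_, rfl⟩
  have hsend : ∀ i, 1 ≤ i → i ≤ m → s' (c i) = n := by
    intro i h1 h2
    have := hbu i (c i) h1 h2 (hcs i h1 h2).2 le_rfl
    simp [hs', this]
  have hsint : ∀ i x, 1 ≤ i → i ≤ m → c (i - 1) < x → x < c i →
      s' x = s (x - c (i - 1) + k (σ i - 1)) - k (σ i - 1) + c (i - 1) := by
    intro i x h1 h2 h3 h4
    simp [hs', hbu i x h1 h2 h3 h4.le, h4.ne]
  have hLmem : ∀ i x, 1 ≤ i → i ≤ m → c (i - 1) < x → x ≤ c i →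
      (x ∈ L' ↔ x - c (i - 1) + k (σ i - 1) ∈ L) := by
    intro i x h1 h2 h3 h4
    have := hcle i h2
    simp only [hL', Finset.mem_filter, hbu i x h1 h2 h3 h4, Finset.mem_Icc]
    exact ⟨fun h => h.2, fun h => ⟨by omega, h⟩⟩
  -- The interior of a block is a translate of the interior of a block of the given tree.
  have hint : ∀ i x, 1 ≤ i → i ≤ m → c (i - 1) < x → x < c i →
      x - c (i - 1) + k (σ i - 1) ∈ Finset.Icc 1 (n - 1) ∧
      x - c (i - 1) + k (σ i - 1) < s (x - c (i - 1) + k (σ i - 1)) ∧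
      s (x - c (i - 1) + k (σ i - 1)) ≤ k (σ i) ∧ x < s' x ∧ s' x ≤ c i := by
    intro i x h1 h2 h3 h4
    obtain ⟨q1, q2⟩ := hσm i h1 h2
    have e := hcs i h1 h2
    have f := hkσ i h1 h2
    have g := hk.bounds q1 q2
    have hm : x - c (i - 1) + k (σ i - 1) ∈ Finset.Icc 1 (n - 1) := by simp; omega
    have u := htree.2.2.1 _ hm
    have v := hk.apply_le htree (x := x - c (i - 1) + k (σ i - 1)) q1 q2 (by omega) (by omega)
    rw [hsint i x h1 h2 h3 h4]
    exact ⟨hm, u, v, by omega, by omega⟩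
  have hcases : ∀ x, x ∈ Finset.Icc 1 (n - 1) → ∃ i, 1 ≤ i ∧ i ≤ m ∧
      (x = c i ∨ c (i - 1) < x ∧ x < c i) := by
    intro x hx
    obtain ⟨p1, p2, p3, p4⟩ := hb x (Finset.mem_Icc.1 hx)
    exact ⟨b x, p1, p2, by omega⟩
  have hsle : ∀ x, x ∈ Finset.Icc 1 (n - 1) → x < s' x ∧ s' x ≤ n := by
    intro x hx
    obtain ⟨i, h1, h2, rfl | ⟨h3, h4⟩⟩ := hcases x hx
    · rw [hsend i h1 h2]
      have := hcle i h2
      omega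
    · have := hint i x h1 h2 h3 h4
      have := hcle i h2
      omega
  refine ⟨s', L', ⟨?_, ?_, fun x hx => (hsle x hx).1, ?_⟩, c, ⟨hc0, hcmono, ?_⟩, ?_⟩
  · intro x hx
    simp only [hL', Finset.mem_filter, Finset.mem_Icc] at hx ⊢
    omega
  · intro x hx
    refine ⟨by have := hsle x hx; simp; omega, ?_⟩
    obtain ⟨i, h1, h2, rfl | ⟨h3, h4⟩⟩ := hcases x hx
    · rw [hsend i h1 h2]
      simp [hL']
      omega
    · obtain ⟨r1, r2, r3, r4, r5⟩ := hint i x h1 h2 h3 h4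
      rw [hLmem i _ h1 h2 (by omega) r5, hsint i x h1 h2 h3 h4]
      convert (htree.2.1 _ r1).2 using 2
      omega
  · intro x y hx hy hxy hys
    obtain ⟨i, h1, h2, rfl | ⟨h3, h4⟩⟩ := hcases x hx
    · rw [hsend i h1 h2]
      exact (hsle y hy).2
    · obtain ⟨r1, r2, r3, r4, r5⟩ := hint i x h1 h2 h3 h4
      obtain ⟨t1, t2, t3, t4, t5⟩ := hint i y h1 h2 (by omega) (by omega)
      rw [hsint i x h1 h2 h3 h4] at hys
      have := htree.2.2.2 _ _ r1 t1 (by omega) (by omega)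
      rw [hsint i x h1 h2 h3 h4, hsint i y h1 h2 (by omega) (by omega)]
      omega
  · intro x
    constructor
    · rintro ⟨hx, hsx⟩
      obtain ⟨i, h1, h2, rfl | ⟨h3, h4⟩⟩ := hcases x hx
      · exact ⟨i, by simp; omega, rfl⟩
      · have := hint i x h1 h2 h3 h4
        have := hcle i h2
        omega
    · rintro ⟨i, hi, rfl⟩
      obtain ⟨h1, h2⟩ := Finset.mem_Icc.1 hi
      have := hcs i h1 h2
      have := hcle i h2
      exact ⟨by simp; omega, hsend i h1 h2⟩
  · intro i hi
    obtain ⟨h1, h2⟩ := Finset.mem_Icc.1 hi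
    have e := hcs i h1 h2
    refine ⟨e.1, ?_, fun j hj => ?_⟩
    · ext j
      simp only [mem_succL, succN, e.1]
      refine and_congr_left fun hj => ?_
      rw [hLmem i _ h1 h2 (by omega) (by omega), Nat.add_sub_cancel]
    · simp only [Finset.mem_Icc, succN] at hj
      simp only [succS]
      rw [hsint i _ h1 h2 (by omega) (by omega), Nat.add_sub_cancel, Nat.add_sub_cancel]

theorem statement1 (n : ℕ) (s : ℕ → ℕ) (L : Finset ℕ)
    (htree : IsTree n s L) (hn : 2 ≤ n)
    (m : ℕ) (k : ℕ → ℕ) (hk : SuccessorData n s m k)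
    (σ : ℕ → ℕ) (hσ : Set.BijOn σ (Set.Icc 1 m) (Set.Icc 1 m)) :
    (∃ s' : ℕ → ℕ, ∃ L' : Finset ℕ, HasPermutedSuccessors n s L m k σ s' L') ∧
    (∀ s₁ L₁ s₂ L₂, HasPermutedSuccessors n s L m k σ s₁ L₁ →
      HasPermutedSuccessors n s L m k σ s₂ L₂ → TreeEq n s₁ L₁ n s₂ L₂) := by
  refine ⟨exists_hasPermutedSuccessors htree hn hk hσ, ?_⟩
  rintro s₁ L₁ s₂ L₂ ⟨h₁, k₁, hk₁, e₁⟩ ⟨h₂, k₂, hk₂, e₂⟩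
  exact treeEq_of_successors hn h₁ h₂ hk₁ hk₂ fun i hi => (e₁ i hi).trans (e₂ i hi).symm
end

section
/- Let (n,s,L) be a tree and let j ∈ {1,…,n−1} ∖ L. Then there exists a unique tree (n−1, s′, L′) such that L′ = τ_{s,j}⁻¹(L) and, for every k ∈ {1,…,n−2}, τ_{s,j}(s′(k)) = s(τ_{s,j}(k)) if s(τ_{s,j}(k)) ≠ j, and τ_{s,j}(s′(k)) = s(j) if s(τ_{s,j}(k)) = j. (This tree is called the edge contraction of (n,s,L) at j.) -/
/-- The map `τ_{s,j} : {1,…,n-1} → {1,…,n}`, `k ↦ k` for `k < j` and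
`k ↦ k+1` for `k ≥ j`; its image is `{1,…,n} ∖ {j}`. -/
def tau (j : ℕ) (x : ℕ) : ℕ := if x < j then x else x + 1

/-- `(n-1, s', L')` is the edge contraction of the tree `(n, s, L)` at `j`:
`L' = τ_{s,j}⁻¹(L)` and `τ_{s,j}(s' k) = s (τ_{s,j} k)` if `s (τ_{s,j} k) ≠ j`,
while `τ_{s,j}(s' k) = s j` if `s (τ_{s,j} k) = j`. -/
def IsEdgeContraction (n : ℕ) (s : ℕ → ℕ) (L : Finset ℕ) (j : ℕ)
    (s' : ℕ → ℕ) (L' : Finset ℕ) : Prop :=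
  IsTree (n - 1) s' L' ∧
  L' = (Finset.Icc 1 (n - 1)).filter (fun x => tau j x ∈ L) ∧
  ∀ x ∈ Finset.Icc 1 (n - 2),
    (s (tau j x) ≠ j → tau j (s' x) = s (tau j x)) ∧
    (s (tau j x) = j → tau j (s' x) = s j)

theorem tau_strictMono (j : ℕ) : StrictMono (tau j) := by
  intro x y h
  grind [tau]

theorem tau_mem_Icc {n j x : ℕ} (hx : x ∈ Finset.Icc 1 (n - 2)) :
    tau j x ∈ Finset.Icc 1 (n - 1) := by
  grind [tau]

/-- The left inverse of `tau j` that collapses `j` and `j - 1`. -/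
def untau (j v : ℕ) : ℕ := if v < j then v else v - 1

theorem tau_untau {j v : ℕ} (h : v ≠ j) : tau j (untau j v) = v := by
  grind [tau, untau]

/-- The successor in `(n, s, L)` after the vertex `j` has been merged into `s j`. -/
def contractSucc (s : ℕ → ℕ) (j x : ℕ) : ℕ := if s x = j then s j else s x

theorem contractSucc_le {n j x y : ℕ} {s : ℕ → ℕ} {L : Finset ℕ} (htree : IsTree n s L)
    (hj : j ∈ Finset.Icc 1 (n - 1)) (hx : x ∈ Finset.Icc 1 (n - 1))
    (hy : y ∈ Finset.Icc 1 (n - 1)) (hxy : x ≤ y) (h : y < contractSucc s j x) :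
    contractSucc s j y ≤ contractSucc s j x := by
  obtain ⟨-, -, hlt, hnest⟩ := htree
  have hltx := hlt x hx
  have hlty := hlt y hy
  have hltj := hlt j hj
  have h₁ := hnest x y hx hy hxy
  have h₂ := hnest j y hj hy
  have h₃ := hnest x j hx hj
  unfold contractSucc at *
  split_ifs at * <;> omega

theorem statement4 (n : ℕ) (s : ℕ → ℕ) (L : Finset ℕ) (htree : IsTree n s L)
    (j : ℕ) (hj : j ∈ Finset.Icc 1 (n - 1)) (hjL : j ∉ L) :
    (∃ s' : ℕ → ℕ, ∃ L' : Finset ℕ, IsEdgeContraction n s L j s' L') ∧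
    (∀ s₁ L₁ s₂ L₂, IsEdgeContraction n s L j s₁ L₁ →
      IsEdgeContraction n s L j s₂ L₂ →
      L₁ = L₂ ∧ ∀ x ∈ Finset.Icc 1 (n - 2), s₁ x = s₂ x) := by
  have hsucc : ∀ x ∈ Finset.Icc 1 (n - 1), contractSucc s j x ≠ j ∧
      contractSucc s j x ∈ Finset.Icc 1 n ∧ contractSucc s j x ∉ L ∧ x < contractSucc s j x := by
    obtain ⟨-, hs, hlt, -⟩ := htree
    intro x hx
    have hsx := hs x hx
    have hsj := hs j hj
    have hltx := hlt x hx
    have hltj := hlt j hj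
    unfold contractSucc
    split_ifs with h
    · exact ⟨by omega, hsj.1, hsj.2, by omega⟩
    · exact ⟨h, hsx.1, hsx.2, hltx⟩
  refine ⟨⟨fun x => untau j (contractSucc s j (tau j x)),
    (Finset.Icc 1 (n - 1)).filter (fun x => tau j x ∈ L),
    ⟨Finset.filter_subset _ _, ?_, ?_, ?_⟩, rfl, ?_⟩, ?_⟩
  · intro x hx
    obtain ⟨hne, hmem, hL, hlt⟩ := hsucc _ (tau_mem_Icc (j := j) hx)
    refine ⟨?_, fun h => hL ?_⟩
    · have := tau_mem_Icc (j := j) hx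
      simp only [Finset.mem_Icc, untau] at *
      split_ifs <;> omega
    · simpa [tau_untau hne] using (Finset.mem_filter.mp h).2
  · intro x hx
    obtain ⟨hne, -, -, hlt⟩ := hsucc _ (tau_mem_Icc (j := j) hx)
    rwa [← (tau_strictMono j).lt_iff_lt, tau_untau hne]
  · intro x y hx hy hxy h
    have hx' := tau_mem_Icc (j := j) hx
    have hy' := tau_mem_Icc (j := j) hy
    rw [← (tau_strictMono j).lt_iff_lt, tau_untau (hsucc _ hx').1] at h
    rw [← (tau_strictMono j).le_iff_le, tau_untau (hsucc _ hx').1, tau_untau (hsucc _ hy').1]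
    exact contractSucc_le htree hj hx' hy' ((tau_strictMono j).monotone hxy) h
  · intro x hx
    simp only [tau_untau (hsucc _ (tau_mem_Icc (j := j) hx)).1]
    unfold contractSucc
    exact ⟨fun h => if_neg h, fun h => if_pos h⟩
  · rintro s₁ L₁ s₂ L₂ ⟨-, rfl, h₁⟩ ⟨-, rfl, h₂⟩
    refine ⟨rfl, fun x hx => (tau_strictMono j).injective ?_⟩
    by_cases h : s (tau j x) = j
    · rw [(h₁ x hx).2 h, (h₂ x hx).2 h]
    · rw [(h₁ x hx).1 h, (h₂ x hx).1 h]
end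

section
/- Let (n,s,L) be a tree and let 1 ≤ i ≤ j ≤ n with j ∉ L, s⁻¹(j) = {i, i+1, …, j−1}, and {i,…,j−1} ⊆ L. Put n′ = n − j + i. Then there exists a unique tree (n′, s′, L′) such that L′ = τ_{s,i,j}⁻¹(L) ∪ {i} and τ_{s,i,j}(s′(k)) = s(τ_{s,i,j}(k)) for all k ∈ {1,…,n′−1}. (This tree is called the leaf contraction of (n,s,L) at (i,j).) -/
/-- The map `τ_{s,i,j} : {1,…,n'} → {1,…,n}` (`n' = n - j + i`), `k ↦ k` for
`k < i` and `k ↦ k + j - i` for `k ≥ i`; its image is `{1,…,n} ∖ {i,…,j-1}`. -/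
def tau2 (i j : ℕ) (x : ℕ) : ℕ := if x < i then x else x + j - i

/-- `(n-j+i, s', L')` is the leaf contraction of the tree `(n, s, L)` at `(i,j)`:
`L' = τ_{s,i,j}⁻¹(L) ∪ {i}` and `τ_{s,i,j}(s' k) = s (τ_{s,i,j} k)` for all `k`
in the domain `{1,…,n-j+i-1}`. -/
def IsLeafContraction (n : ℕ) (s : ℕ → ℕ) (L : Finset ℕ) (i j : ℕ)
    (s' : ℕ → ℕ) (L' : Finset ℕ) : Prop :=
  IsTree (n - j + i) s' L' ∧
  L' = (Finset.Icc 1 (n - j + i)).filter (fun x => tau2 i j x ∈ L) ∪ {i} ∧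
  ∀ x ∈ Finset.Icc 1 (n - j + i - 1), tau2 i j (s' x) = s (tau2 i j x)

theorem tau2_strictMono {i j : ℕ} (h : i ≤ j) : StrictMono (tau2 i j) := by
  intro x y hxy
  unfold tau2
  split_ifs <;> omega

theorem exists_tau2_eq {n i j y : ℕ} (h2 : i ≤ j) (h3 : j ≤ n) (hy : y ∈ Finset.Icc 1 n)
    (h1 : 1 ≤ i) (hij : y ∉ Finset.Icc i (j - 1)) :
    ∃ x ∈ Finset.Icc 1 (n - j + i), tau2 i j x = y := by
  simp only [Finset.mem_Icc] at *
  by_cases h : y < i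
  · exact ⟨y, by omega, by simp [tau2, h]⟩
  · refine ⟨y + i - j, by omega, ?_⟩
    unfold tau2
    split_ifs <;> omega

theorem tau2_mem_Icc {n i j x : ℕ} (h2 : i ≤ j) (h3 : j ≤ n)
    (hx : x ∈ Finset.Icc 1 (n - j + i - 1)) :
    tau2 i j x ∈ Finset.Icc 1 (n - 1) := by
  simp only [Finset.mem_Icc] at *
  unfold tau2
  split_ifs <;> omega

theorem tau2_not_mem_gap (i j x : ℕ) : ¬ (i ≤ tau2 i j x ∧ tau2 i j x < j) := by
  unfold tau2
  split_ifs <;> omega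

theorem tau2_self {i j : ℕ} : tau2 i j i = j := by
  simp [tau2]

theorem statement6 (n : ℕ) (s : ℕ → ℕ) (L : Finset ℕ) (htree : IsTree n s L)
    (i j : ℕ) (h1 : 1 ≤ i) (h2 : i ≤ j) (h3 : j ≤ n) (hjL : j ∉ L)
    (hpre : ∀ x ∈ Finset.Icc 1 (n - 1), (s x = j ↔ i ≤ x ∧ x < j))
    (hsub : Finset.Icc i (j - 1) ⊆ L) :
    (∃ s' : ℕ → ℕ, ∃ L' : Finset ℕ, IsLeafContraction n s L i j s' L') ∧
    (∀ s₁ L₁ s₂ L₂, IsLeafContraction n s L i j s₁ L₁ →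
      IsLeafContraction n s L i j s₂ L₂ →
      L₁ = L₂ ∧ ∀ x ∈ Finset.Icc 1 (n - j + i - 1), s₁ x = s₂ x) := by
  obtain ⟨-, hs, hlt, hnest⟩ := htree
  have hmono := tau2_strictMono h2
  constructor
  · have hlift : ∀ x, ∃ z, x ∈ Finset.Icc 1 (n - j + i - 1) →
        z ∈ Finset.Icc 1 (n - j + i) ∧ tau2 i j z = s (tau2 i j x) := by
      intro x
      by_cases hx : x ∈ Finset.Icc 1 (n - j + i - 1)
      · obtain ⟨hmem, hleaf⟩ := hs _ (tau2_mem_Icc h2 h3 hx)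
        obtain ⟨z, hz⟩ := exists_tau2_eq h2 h3 hmem h1 fun h => hleaf (hsub h)
        exact ⟨z, fun _ => hz⟩
      · exact ⟨0, fun h => absurd h hx⟩
    choose s' hs' using hlift
    refine ⟨s', _, ⟨?_, ?_, ?_, ?_⟩, rfl, fun x hx => (hs' x hx).2⟩
    · refine Finset.union_subset (Finset.filter_subset _ _) ?_
      simp only [Finset.singleton_subset_iff, Finset.mem_Icc]
      omega
    · intro x hx
      obtain ⟨hmem, heq⟩ := hs' x hx
      refine ⟨hmem, ?_⟩
      have hx' := tau2_mem_Icc h2 h3 hx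
      simp only [Finset.mem_union, Finset.mem_filter, Finset.mem_singleton, heq]
      rintro (⟨-, h⟩ | h)
      · exact (hs _ hx').2 h
      · rw [h, tau2_self] at heq
        exact tau2_not_mem_gap i j x ((hpre _ hx').1 heq.symm)
    · intro x hx
      rw [← hmono.lt_iff_lt, (hs' x hx).2]
      exact hlt _ (tau2_mem_Icc h2 h3 hx)
    · intro x y hx hy hxy hys
      rw [← hmono.lt_iff_lt, (hs' x hx).2] at hys
      rw [← hmono.le_iff_le, (hs' x hx).2, (hs' y hy).2]
      exact hnest _ _ (tau2_mem_Icc h2 h3 hx) (tau2_mem_Icc h2 h3 hy) (hmono.monotone hxy) hys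
  · rintro s₁ L₁ s₂ L₂ ⟨-, rfl, e₁⟩ ⟨-, rfl, e₂⟩
    exact ⟨rfl, fun x hx => hmono.injective ((e₁ x hx).trans (e₂ x hx).symm)⟩
end

section
/- Let C₁, C₂ be categories with classes of equivalences E₁ ⊆ Mor(C₁), E₂ ⊆ Mor(C₂). Assume: (1) (C₁, E₁) has a derived category Φ₁ : C₁ → DC₁; (2) there are functors F : C₁ → C₂ and G : C₂ → C₁ which preserve equivalences (F sends E₁ into E₂ and G sends E₂ into E₁), together with natural transformations ε : F∘G → Id_{C₂} and ζ : G∘F → Id_{C₁} all of whose components lie in E₂ and E₁, respectively. Then (C₂, E₂) has a derived category Φ₂ : C₂ → DC₂, and there exist functors DF : DC₁ → DC₂ and DG : DC₂ → DC₁, natural isomorphisms Dε : DF∘DG ≅ Id and Dζ : DG∘DF ≅ Id, and natural isomorphisms κ : Φ₂∘F ≅ DF∘Φ₁ and λ : Φ₁∘G ≅ DG∘Φ₂, satisfying the coherence identities Dζ ∘ (DG κ) ∘ (λF) = Φ₁ζ (as natural isomorphisms Φ₁∘G∘F ≅ Φ₁, where Φ₁ζ is invertible since each component of ζ lies in E₁)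 and Dε ∘ (DF λ) ∘ (κG) = Φ₂ε (as natural isomorphisms Φ₂∘F∘G ≅ Φ₂, where Φ₂ε is invertible since each component of ε lies in E₂). In particular, F and G induce an equivalence of derived categories DC₁ ≃ DC₂. -/
open CategoryTheory

universe v u

/-- `Φ : C ⥤ D` exhibits `D` as a derived category of `C` with respect to the
class of equivalences `E`: `Φ` inverts `E`, and for every functor `F : C ⥤ B`
inverting `E` there are `DF : D ⥤ B` and a natural isomorphism `η : F ≅ Φ ⋙ DF`,
unique in the sense that for any other `(DF', η')` there is a unique natural
isomorphism `ξ : DF ≅ DF'` with `ξΦ = η' ∘ η⁻¹`. -/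
def IsDerivedCategoryOf {C : Type u} [Category.{v} C] (E : MorphismProperty C)
    {D : Type u} [Category.{v} D] (Φ : C ⥤ D) : Prop :=
  (∀ ⦃x y : C⦄ (φ : x ⟶ y), E φ → IsIso (Φ.map φ)) ∧
  (∀ (B : Type u) [Category.{v} B] (F : C ⥤ B),
    (∀ ⦃x y : C⦄ (φ : x ⟶ y), E φ → IsIso (F.map φ)) →
    ∃ (DF : D ⥤ B) (η : F ≅ Φ ⋙ DF),
      ∀ (DF' : D ⥤ B) (η' : F ≅ Φ ⋙ DF'),
        ∃! ξ : DF ≅ DF', ∀ c : C, ξ.hom.app (Φ.obj c) = η.inv.app c ≫ η'.hom.app c)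

namespace IsDerivedCategoryOf

section

variable {C D B : Type u} [Category.{v} C] [Category.{v} D] [Category.{v} B]
  {E : MorphismProperty C} {Φ : C ⥤ D}

/-- Natural isomorphisms between functors out of a derived category are determined by, and can be
lifted from, their restrictions along the localization functor. -/
theorem existsUnique_lift_iso (h : IsDerivedCategoryOf E Φ) (K K' : D ⥤ B)
    (β : Φ ⋙ K ≅ Φ ⋙ K') :
    ∃! ξ : K ≅ K', ∀ c : C, ξ.hom.app (Φ.obj c) = β.hom.app c := by
  obtain ⟨L, η, hη⟩ := h.2 B (Φ ⋙ K) fun x y φ hφ => by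
    have := h.1 φ hφ
    exact inferInstanceAs (IsIso (K.map (Φ.map φ)))
  obtain ⟨ξ₁, h₁, -⟩ := hη K (Iso.refl _)
  obtain ⟨ξ₂, h₂, hu⟩ := hη K' β
  have h₁' (c : C) : ξ₁.hom.app (Φ.obj c) = η.inv.app c := by simpa using h₁ c
  refine ⟨ξ₁.symm ≪≫ ξ₂, fun c => ?_, fun ξ hξ => ?_⟩
  · rw [Iso.trans_hom, NatTrans.comp_app, h₂, ← h₁']
    exact Iso.inv_hom_id_app_assoc ξ₁ _ _
  · have : ξ₁ ≪≫ ξ = ξ₂ := hu _ fun c => by simp [h₁', hξ]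
    rw [← this, Iso.symm_self_id_assoc]

/-- A functor inverting `E` along which functors inverting `E` factor and natural isomorphisms
lift uniquely is a derived category. -/
theorem of_existsUnique_lift_iso
    (hΦ : ∀ ⦃x y : C⦄ (φ : x ⟶ y), E φ → IsIso (Φ.map φ))
    (hfac : ∀ (B : Type u) [Category.{v} B] (F : C ⥤ B),
      (∀ ⦃x y : C⦄ (φ : x ⟶ y), E φ → IsIso (F.map φ)) →
        ∃ DF : D ⥤ B, Nonempty (F ≅ Φ ⋙ DF))
    (hlift : ∀ (B : Type u) [Category.{v} B] (K K' : D ⥤ B) (β : Φ ⋙ K ≅ Φ ⋙ K'),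
      ∃! ξ : K ≅ K', ∀ c : C, ξ.hom.app (Φ.obj c) = β.hom.app c) :
    IsDerivedCategoryOf E Φ := by
  refine ⟨hΦ, fun B _ F hF => ?_⟩
  obtain ⟨DF, ⟨η⟩⟩ := hfac B F hF
  exact ⟨DF, η, fun DF' η' => hlift B DF DF' (η.symm ≪≫ η')⟩

end

section

variable {C₁ C₂ D : Type u} [Category.{v} C₁] [Category.{v} C₂] [Category.{v} D]
  {E₁ : MorphismProperty C₁} {E₂ : MorphismProperty C₂} {Φ : C₁ ⥤ D}
  {F : C₁ ⥤ C₂} {G : C₂ ⥤ C₁}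

/-- If `G` has a two-sided inverse up to natural equivalences, then natural isomorphisms between
functors out of a derived category of `C₁` lift uniquely along `G ⋙ Φ`. No triangle identity
relating `ε` and `ζ` is needed. -/
theorem existsUnique_lift_iso_comp (h : IsDerivedCategoryOf E₁ Φ)
    (hG : ∀ ⦃x y : C₂⦄ (φ : x ⟶ y), E₂ φ → E₁ (G.map φ))
    (ε : G ⋙ F ⟶ 𝟭 C₂) (hε : ∀ c : C₂, E₂ (ε.app c))
    (ζ : F ⋙ G ⟶ 𝟭 C₁) (hζ : ∀ c : C₁, E₁ (ζ.app c))
    {B : Type u} [Category.{v} B] (K K' : D ⥤ B) (α : (G ⋙ Φ) ⋙ K ≅ (G ⋙ Φ) ⋙ K') :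
    ∃! ξ : K ≅ K', ∀ c : C₂, ξ.hom.app ((G ⋙ Φ).obj c) = α.hom.app c := by
  have isoζ (x : C₁) : IsIso (Φ.map (ζ.app x)) := h.1 _ (hζ x)
  have isoε (c : C₂) : IsIso (Φ.map (G.map (ε.app c))) := h.1 _ (hG _ (hε c))
  let Z : F ⋙ G ⋙ Φ ≅ Φ :=
    NatIso.ofComponents (fun x => asIso (Φ.map (ζ.app x))) fun f => by
      simpa using congrArg Φ.map (ζ.naturality f)
  have hZ (x : C₁) : Z.hom.app x = Φ.map (ζ.app x) := rfl
  let β : Φ ⋙ K ≅ Φ ⋙ K' :=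
    (Functor.isoWhiskerRight Z K).symm ≪≫ Functor.isoWhiskerLeft F α ≪≫
      Functor.isoWhiskerRight Z K'
  have hβ (x : C₁) :
      K.map (Φ.map (ζ.app x)) ≫ β.hom.app x = α.hom.app (F.obj x) ≫ K'.map (Φ.map (ζ.app x)) := by
    rw [← hZ]
    simp [β, ← Functor.map_comp_assoc]
  obtain ⟨ξ, hξ, hu⟩ := h.existsUnique_lift_iso K K' β
  have hζζ (x : C₁) : Φ.map (ζ.app (G.obj (F.obj x))) = Φ.map (G.map (F.map (ζ.app x))) := by
    rw [← cancel_mono (Φ.map (ζ.app x)), ← Φ.map_comp, ← Φ.map_comp]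
    exact congrArg Φ.map (ζ.naturality (ζ.app x)).symm
  have hξF (x : C₁) : ξ.hom.app (Φ.obj (G.obj (F.obj x))) = α.hom.app (F.obj x) := by
    have e := hβ (G.obj (F.obj x))
    rw [hζζ] at e
    have n := α.hom.naturality (F.map (ζ.app x))
    have : IsIso (Φ.map (G.map (F.map (ζ.app x)))) := hζζ x ▸ isoζ _
    rw [hξ, ← cancel_epi (K.map (Φ.map (G.map (F.map (ζ.app x)))))]
    exact e.trans n.symm
  refine ⟨ξ, fun c => ?_, fun ξ' hξ' => hu ξ' fun x => ?_⟩
  · rw [← cancel_epi (K.map (Φ.map (G.map (ε.app c))))]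
    have n := ξ.hom.naturality (Φ.map (G.map (ε.app c)))
    have n' := α.hom.naturality (ε.app c)
    refine n.trans (Eq.trans ?_ n'.symm)
    exact congrArg (· ≫ K'.map (Φ.map (G.map (ε.app c)))) (hξF (G.obj c))
  · rw [← cancel_epi (K.map (Φ.map (ζ.app x))), hβ, ← hξ' (F.obj x)]
    exact ξ'.hom.naturality (Φ.map (ζ.app x))

/-- If `F` and `G` are mutually inverse up to natural equivalences, then a derived category `Φ` of
`C₁` induces the derived category `G ⋙ Φ` of `C₂`. -/
theorem comp_of_natural_equivalences (h : IsDerivedCategoryOf E₁ Φ)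
    (hF : ∀ ⦃x y : C₁⦄ (φ : x ⟶ y), E₁ φ → E₂ (F.map φ))
    (hG : ∀ ⦃x y : C₂⦄ (φ : x ⟶ y), E₂ φ → E₁ (G.map φ))
    (ε : G ⋙ F ⟶ 𝟭 C₂) (hε : ∀ c : C₂, E₂ (ε.app c))
    (ζ : F ⋙ G ⟶ 𝟭 C₁) (hζ : ∀ c : C₁, E₁ (ζ.app c)) :
    IsDerivedCategoryOf E₂ (G ⋙ Φ) := by
  refine of_existsUnique_lift_iso (fun x y φ hφ => h.1 _ (hG φ hφ)) (fun B _ H hH => ?_)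
    (fun B _ K K' α => h.existsUnique_lift_iso_comp hG ε hε ζ hζ K K' α)
  obtain ⟨DH, η, -⟩ := h.2 B (F ⋙ H) fun x y φ hφ => hH _ (hF φ hφ)
  have isoε (c : C₂) : IsIso (H.map (ε.app c)) := hH _ (hε c)
  let e : G ⋙ F ⋙ H ≅ H :=
    NatIso.ofComponents (fun c => asIso (H.map (ε.app c))) fun f => by
      simpa using congrArg H.map (ε.naturality f)
  exact ⟨DH, ⟨e.symm ≪≫ Functor.isoWhiskerLeft G η⟩⟩

end

end IsDerivedCategoryOf

theorem statement12 {C₁ C₂ : Type u} [Category.{v} C₁] [Category.{v} C₂]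
    (E₁ : MorphismProperty C₁) (E₂ : MorphismProperty C₂)
    {DC₁ : Type u} [Category.{v} DC₁] (Φ₁ : C₁ ⥤ DC₁)
    (h₁ : IsDerivedCategoryOf E₁ Φ₁)
    (F : C₁ ⥤ C₂) (G : C₂ ⥤ C₁)
    (hF : ∀ ⦃x y : C₁⦄ (φ : x ⟶ y), E₁ φ → E₂ (F.map φ))
    (hG : ∀ ⦃x y : C₂⦄ (φ : x ⟶ y), E₂ φ → E₁ (G.map φ))
    (ε : G ⋙ F ⟶ Functor.id C₂) (hε : ∀ c : C₂, E₂ (ε.app c))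
    (ζ : F ⋙ G ⟶ Functor.id C₁) (hζ : ∀ c : C₁, E₁ (ζ.app c)) :
    ∃ (DC₂ : Cat.{v, u}) (Φ₂ : C₂ ⥤ DC₂), IsDerivedCategoryOf E₂ Φ₂ ∧
      ∃ (DF : DC₁ ⥤ DC₂) (DG : DC₂ ⥤ DC₁)
        (Dε : DG ⋙ DF ≅ Functor.id DC₂) (Dζ : DF ⋙ DG ≅ Functor.id DC₁)
        (κ : F ⋙ Φ₂ ≅ Φ₁ ⋙ DF) (lam : G ⋙ Φ₁ ≅ Φ₂ ⋙ DG),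
        (∀ c : C₁,
          lam.hom.app (F.obj c) ≫ DG.map (κ.hom.app c) ≫ Dζ.hom.app (Φ₁.obj c) =
            Φ₁.map (ζ.app c)) ∧
        (∀ c : C₂,
          κ.hom.app (G.obj c) ≫ DF.map (lam.hom.app c) ≫ Dε.hom.app (Φ₂.obj c) =
            Φ₂.map (ε.app c)) := by
  have isoζ (x : C₁) : IsIso (Φ₁.map (ζ.app x)) := h₁.1 _ (hζ x)
  have isoε (c : C₂) : IsIso (Φ₁.map (G.map (ε.app c))) := h₁.1 _ (hG _ (hε c))
  let Z : F ⋙ G ⋙ Φ₁ ≅ Φ₁ :=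
    NatIso.ofComponents (fun x => asIso (Φ₁.map (ζ.app x))) fun f => by
      simpa using congrArg Φ₁.map (ζ.naturality f)
  let W : G ⋙ F ⋙ G ⋙ Φ₁ ≅ G ⋙ Φ₁ :=
    NatIso.ofComponents (fun c => asIso (Φ₁.map (G.map (ε.app c)))) fun f => by
      simpa using congrArg (fun g => Φ₁.map (G.map g)) (ε.naturality f)
  obtain ⟨Dε, hDε, -⟩ := h₁.existsUnique_lift_iso_comp hG ε hε ζ hζ (𝟭 DC₁) (𝟭 DC₁)
    ((Functor.isoWhiskerLeft G Z).symm ≪≫ W)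
  refine ⟨Cat.of DC₁, G ⋙ Φ₁, h₁.comp_of_natural_equivalences hF hG ε hε ζ hζ,
    𝟭 DC₁, 𝟭 DC₁, Dε, Iso.refl _, Z, Iso.refl _, fun c => ?_, fun c => ?_⟩
  · change 𝟙 _ ≫ Φ₁.map (ζ.app c) ≫ 𝟙 _ = _
    simp
  · change Z.hom.app (G.obj c) ≫ 𝟙 _ ≫ Dε.hom.app ((G ⋙ Φ₁).obj c) = Φ₁.map (G.map (ε.app c))
    rw [hDε, Category.id_comp]
    exact Iso.hom_inv_id_app_assoc Z (G.obj c) (W.hom.app c)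
end
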